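/- (Greedy optimality for separable concave maximization) Let f_1,...,f_I : ℕ → ℝ be functions with nonincreasing increments (f_i(n+1) - f_i(n) is nonincreasing in n, i.e., each f_i is discretely concave), and consider maximizing Σ_i f_i(n_i) subject to n_i ≤ N_i and Σ_i n_i ≤ T over nonnegative integers n_i. Then the greedy algorithm that, starting from n = 0, repeatedly increments the coordinate i with the largest marginal gain f_i(n_i + 1) - f_i(n_i) (among those with n_i < N_i), stopping when T units are allocated or all marginal gains are nonpositive, produces an optimal solution. -/

import Mathlib

/- One step of the greedy algorithm (Algorithm 1, separable case): if budget
remains and some coordinate with remaining capacity has a positive marginal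
gain that is maximal among all available coordinates, increment it;
otherwise stop (return the allocation unchanged). -/
open Classical in
noncomputable def greedyStep {ι : Type*} [Fintype ι] [DecidableEq ι]
    (f : ι → ℕ → ℝ) (N : ι → ℕ) (T : ℕ) (n : ι → ℕ) : ι → ℕ :=
  if h : (∑ j, n j) < T ∧ ∃ i, n i < N i ∧ 0 < f i (n i + 1) - f i (n i) ∧
      (∀ j, n j < N j → f j (n j + 1) - f j (n j) ≤ f i (n i + 1) - f i (n i))
  then Function.update n h.2.choose (n h.2.choose + 1)
  else n

theorem marg_anti (g : ℕ → ℝ) (h : ∀ k, g (k + 2) - g (k + 1) ≤ g (k + 1) - g k)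
    (a d : ℕ) : g (a + d + 1) - g (a + d) ≤ g (a + 1) - g a := by
  induction d with
  | zero => simp
  | succ d ih =>
    have := h (a + d)
    have e1 : a + (d + 1) + 1 = a + d + 2 := by omega
    have e2 : a + (d + 1) = a + d + 1 := by omega
    rw [e1, e2]
    linarith

theorem le_of_marg (g : ℕ → ℝ) (h : ∀ k, g (k + 2) - g (k + 1) ≤ g (k + 1) - g k)
    (a d : ℕ) (ha : g (a + 1) - g a ≤ 0) : g (a + d) ≤ g a := by
  induction d with
  | zero => simp
  | succ d ih =>
    have := marg_anti g h a d
    have e2 : a + (d + 1) = a + d + 1 := by omega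
    rw [e2]
    linarith

theorem eq_of_le_sum {ι : Type*} [Fintype ι] (n m : ι → ℕ) (h : ∀ i, n i ≤ m i)
    (hs : ∑ i, m i ≤ ∑ i, n i) : m = n := by
  have h1 := (Finset.sum_eq_sum_iff_of_le (s := Finset.univ) (f := n) (g := m)
    (fun i _ => h i)).1 (le_antisymm (Finset.sum_le_sum fun i _ => h i) hs)
  funext i
  exact (h1 i (Finset.mem_univ i)).symm

theorem sum_upd {ι : Type*} [Fintype ι] [DecidableEq ι] {M : Type*} [AddCommGroup M]
    (f : ι → ℕ → M) (n : ι → ℕ) (i : ι) (v : ℕ) :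
    ∑ j, f j (Function.update n i v j) = ∑ j, f j (n j) + (f i v - f i (n i)) := by
  rw [← Finset.add_sum_erase _ _ (Finset.mem_univ i),
    ← Finset.add_sum_erase (a := i) _ (fun j => f j (n j)) (Finset.mem_univ i)]
  have : ∑ j ∈ Finset.univ.erase i, f j (Function.update n i v j)
      = ∑ j ∈ Finset.univ.erase i, f j (n j) := by
    apply Finset.sum_congr rfl
    intro j hj
    rw [Function.update_of_ne (Finset.ne_of_mem_erase hj)]
  rw [this, Function.update_self]
  abel

theorem sum_updN {ι : Type*} [Fintype ι] [DecidableEq ι] (n : ι → ℕ) (i : ι) (v : ℕ) :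
    ∑ j, Function.update n i v j + n i = ∑ j, n j + v := by
  have := sum_upd (fun _ k => (k : ℤ)) n i v
  zify
  linarith

theorem greedy_aux {ι : Type*} [Fintype ι] [DecidableEq ι]
    (f : ι → ℕ → ℝ) (N : ι → ℕ) (T : ℕ)
    (hconc : ∀ i k, f i (k + 2) - f i (k + 1) ≤ f i (k + 1) - f i k) (r : ℕ) :
    ∀ (n m : ι → ℕ), T ≤ ∑ i, n i + r → (∀ i, n i ≤ m i) → (∀ i, m i ≤ N i) →
      ∑ i, m i ≤ T → ∑ i, f i (m i) ≤ ∑ i, f i ((greedyStep f N T)^[r] n i) := by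
  induction r with
  | zero =>
    intro n m hr hnm hm hmT
    rw [eq_of_le_sum n m hnm (by omega)]
    simp
  | succ r ih =>
    intro n m hr hnm hm hmT
    by_cases h : (∑ j, n j) < T ∧ ∃ i, n i < N i ∧ 0 < f i (n i + 1) - f i (n i) ∧
      (∀ j, n j < N j → f j (n j + 1) - f j (n j) ≤ f i (n i + 1) - f i (n i))
    · obtain ⟨i, hstep, hiN, hpos, hmax⟩ : ∃ i, greedyStep f N T n =
          Function.update n i (n i + 1) ∧ n i < N i ∧ 0 < f i (n i + 1) - f i (n i) ∧
          (∀ j, n j < N j → f j (n j + 1) - f j (n j) ≤ f i (n i + 1) - f i (n i)) :=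
        ⟨h.2.choose, by rw [greedyStep, dif_pos h], h.2.choose_spec⟩
      rw [Function.iterate_succ_apply, hstep]
      have hs := sum_updN n i (n i + 1)
      have key : ∃ m' : ι → ℕ, (∀ j, n j ≤ m' j) ∧ n i + 1 ≤ m' i ∧ (∀ j, m' j ≤ N j) ∧
          ∑ j, m' j ≤ T ∧ ∑ j, f j (m j) ≤ ∑ j, f j (m' j) := by
        by_cases hi : n i < m i
        · exact ⟨m, hnm, hi, hm, hmT, le_rfl⟩
        have hmi : m i = n i := le_antisymm (not_lt.1 hi) (hnm i)
        have hsm := sum_updN m i (m i + 1)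
        have hfm := sum_upd f m i (m i + 1)
        have h1 : ∀ j, n j ≤ Function.update m i (m i + 1) j := by
          intro j
          have := hnm j
          by_cases hj : j = i
          · subst hj; simp; omega
          · simpa [hj] using this
        have h2 : ∀ j, Function.update m i (m i + 1) j ≤ N j := by
          intro j
          have := hm j
          by_cases hj : j = i
          · subst hj; simp; omega
          · simpa [hj] using this
        by_cases hT : ∑ j, m j < T
        · refine ⟨Function.update m i (m i + 1), h1, by simp [hmi], h2, by omega, ?_⟩
          rw [hfm, hmi]; linarith
        · obtain ⟨j, hj⟩ : ∃ j, n j < m j := by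
            by_contra hc
            push Not at hc
            have := Finset.sum_le_sum (s := Finset.univ) fun j _ => hc j
            omega
          have hji : j ≠ i := by rintro rfl; omega
          set p := Function.update m i (m i + 1) with hp
          have hpj : p j = m j := by rw [hp, Function.update_of_ne hji]
          have hsq := sum_updN p j (m j - 1)
          have hfq := sum_upd f p j (m j - 1)
          refine ⟨Function.update p j (m j - 1), ?_, ?_, ?_, by omega, ?_⟩
          · intro k
            have := h1 k
            by_cases hk : k = j
            · subst hk; simp; omega
            · simpa [hk] using this
          · rw [Function.update_of_ne hji.symm]; simp [hp, hmi]
          · intro k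
            have := h2 k
            by_cases hk : k = j
            · subst hk; simp; omega
            · simpa [hk] using this
          · rw [hfq, hfm, hpj, hmi]
            obtain ⟨d, hd⟩ : ∃ d, m j = n j + d + 1 := ⟨m j - n j - 1, by omega⟩
            have a1 := marg_anti (f j) (hconc j) (n j) d
            have a2 := hmax j (lt_of_lt_of_le hj (hm j))
            have e : m j - 1 = n j + d := by omega
            rw [e, hd]
            linarith
      obtain ⟨m', k1, k2, k3, k4, k5⟩ := key
      refine k5.trans (ih _ m' (by omega) ?_ k3 k4)
      intro j
      by_cases hj : j = i
      · subst hj; simpa using k2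
      · simpa [hj] using k1 j
    · have hstep : greedyStep f N T n = n := by rw [greedyStep, dif_neg h]
      rw [Function.iterate_fixed hstep]
      by_cases hT : ∑ j, n j < T
      · have hnon : ∀ j, n j < N j → f j (n j + 1) - f j (n j) ≤ 0 := by
          intro j hj
          by_contra hc
          push Not at hc
          obtain ⟨i, hi, hmax⟩ := Finset.exists_max_image
            (Finset.univ.filter fun j => n j < N j)
            (fun j => f j (n j + 1) - f j (n j)) ⟨j, by simpa using hj⟩
          simp only [Finset.mem_filter, Finset.mem_univ, true_and] at hi hmax
          exact h ⟨hT, i, hi, hc.trans_le (hmax j hj), hmax⟩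
        apply Finset.sum_le_sum
        intro j _
        rcases (hnm j).eq_or_lt with he | hl
        · rw [he]
        · obtain ⟨d, hd⟩ := Nat.exists_eq_add_of_le (hnm j)
          rw [hd]
          exact le_of_marg (f j) (hconc j) _ d (hnon j (lt_of_lt_of_le hl (hm j)))
      · rw [eq_of_le_sum n m hnm (by omega)]

/-- Greedy optimality for separable concave maximization: if each
f_i has nonincreasing increments, the greedy algorithm starting from 0 (run for
T steps, after which it has surely stopped) maximizes Σ_i f_i(n_i) subject to
n_i ≤ N_i and Σ_i n_i ≤ T. -/
theorem stmt4 {ι : Type*} [Fintype ι] [DecidableEq ι]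
    (f : ι → ℕ → ℝ) (N : ι → ℕ) (T : ℕ)
    (hconc : ∀ i k, f i (k + 2) - f i (k + 1) ≤ f i (k + 1) - f i k)
    (m : ι → ℕ) (hm : ∀ i, m i ≤ N i) (hmT : ∑ i, m i ≤ T) :
    ∑ i, f i (m i) ≤ ∑ i, f i ((greedyStep f N T)^[T] (fun _ => 0) i) := by
  exact greedy_aux f N T hconc T _ m (by simp) (fun _ => Nat.zero_le _) hm hmT
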